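/- Let F be a perfect field and let A be an affine domain over F with trdeg_F(A) = 1. Then for every natural number n, AK(A[x₁,…,xₙ]) = AK(A), where A is identified with the subalgebra of constant polynomials in A[x₁,…,xₙ]. -/

import Mathlib

open Polynomial TensorProduct

/-- An *exponential map* on a commutative `k`-algebra `A` is a `k`-algebra homomorphism
`φ : A → A[t]` such that evaluation at `t = 0` composed with `φ` is the identity, and
applying `φ` coefficientwise to `φ a` equals substituting `s + t` for `t` in `φ a`. -/
def IsExponential {k A : Type*} [CommRing k] [CommRing A] [Algebra k A]
    (φ : A →ₐ[k] A[X]) : Prop :=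
  (∀ a : A, (φ a).eval 0 = a) ∧
  (∀ a : A, (φ a).map (φ : A →+* A[X]) =
      (φ a).eval₂ ((C : A[X] →+* A[X][X]).comp (C : A →+* A[X])) (X + C X))

/-- The ring of `φ`-invariants `A^φ = {a : A | φ a = C a}`. -/
noncomputable def expInvariants {k A : Type*} [CommRing k] [CommRing A] [Algebra k A]
    (φ : A →ₐ[k] A[X]) : Subalgebra k A :=
  AlgHom.equalizer φ ((Algebra.ofId A A[X]).restrictScalars k)

/-- The AK invariant (ring of absolute constants) of a commutative `k`-algebra `A`:
the intersection of `A^φ` over all exponential maps `φ` on `A`. -/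
noncomputable def AK (k A : Type*) [CommRing k] [CommRing A] [Algebra k A] : Subalgebra k A :=
  ⨅ φ : {ψ : A →ₐ[k] A[X] // IsExponential ψ}, expInvariants φ.1

/-- `A` has transcendence degree 1 over `k`: some single element is a transcendence basis. -/
def TrdegOne (k A : Type*) [CommRing k] [CommRing A] [Algebra k A] : Prop :=
  ∃ x : A, IsTranscendenceBasis k (fun _ : Unit => x)

universe u

/-- The polynomials which are quotients of two elements of the subalgebra `R`. -/
noncomputable def fractionPolynomials {K : Type*} [Field K] (R : Subalgebra K K[X]) :
    Subalgebra K K[X] where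
  carrier := {f | ∃ b ∈ R, b ≠ 0 ∧ b * f ∈ R}
  mul_mem' := by
    rintro f g ⟨b, hb, hb0, hf⟩ ⟨c, hc, hc0, hg⟩
    exact ⟨b * c, R.mul_mem hb hc, mul_ne_zero hb0 hc0, by
      simpa [mul_mul_mul_comm] using R.mul_mem hf hg⟩
  add_mem' := by
    rintro f g ⟨b, hb, hb0, hf⟩ ⟨c, hc, hc0, hg⟩
    refine ⟨b * c, R.mul_mem hb hc, mul_ne_zero hb0 hc0, ?_⟩
    have : b * c * (f + g) = c * (b * f) + b * (c * g) := by ring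
    rw [this]
    exact R.add_mem (R.mul_mem hc hf) (R.mul_mem hb hg)
  algebraMap_mem' r := ⟨1, R.one_mem, one_ne_zero, by simpa using R.algebraMap_mem r⟩

theorem le_fractionPolynomials {K : Type*} [Field K] (R : Subalgebra K K[X]) :
    R ≤ fractionPolynomials R := fun f hf => ⟨1, R.one_mem, one_ne_zero, by simpa using hf⟩

theorem mem_fractionPolynomials_of_mul_eq {K : Type*} [Field K] {R : Subalgebra K K[X]}
    {p q f : K[X]} (hp : p ∈ fractionPolynomials R) (hq : q ∈ fractionPolynomials R) (hq0 : q ≠ 0)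
    (h : q * f = p) : f ∈ fractionPolynomials R := by
  obtain ⟨c, hc, hc0, hcp⟩ := hp
  obtain ⟨b, hb, hb0, hbq⟩ := hq
  refine ⟨c * (b * q), R.mul_mem hc hbq, mul_ne_zero hc0 (mul_ne_zero hb0 hq0), ?_⟩
  have : c * (b * q) * f = b * (c * p) := by rw [← h]; ring
  rw [this]
  exact R.mul_mem hb hcp

theorem isIntegrallyClosed_fractionPolynomials {K : Type*} [Field K] (R : Subalgebra K K[X]) :
    IsIntegrallyClosed (fractionPolynomials R) := by
  let S := fractionPolynomials R
  have hinj : Function.Injective (algebraMap S (FractionRing K[X])) := by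
    rw [IsScalarTower.algebraMap_eq S K[X] (FractionRing K[X])]
    exact (IsFractionRing.injective K[X] _).comp Subtype.val_injective
  rw [isIntegrallyClosed_iff (FractionRing S)]
  intro x hx
  obtain ⟨p, q, hq, rfl⟩ := IsFractionRing.div_surjective (A := S) x
  have hq0 : q ≠ 0 := nonZeroDivisors.ne_zero hq
  let l : FractionRing S →ₐ[S] FractionRing K[X] :=
    IsFractionRing.liftAlgHom (g := Algebra.ofId S _) hinj
  have hx' : IsIntegral K[X] (l (algebraMap S _ p / algebraMap S _ q)) :=
    (hx.map l).tower_top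
  obtain ⟨f, hf⟩ := IsIntegrallyClosed.isIntegral_iff.mp hx'
  have hqf : (q : K[X]) * f = p := by
    apply IsFractionRing.injective K[X] (FractionRing K[X])
    rw [map_mul, hf, map_div₀, l.commutes, l.commutes,
      IsScalarTower.algebraMap_apply S K[X] (FractionRing K[X]) p,
      IsScalarTower.algebraMap_apply S K[X] (FractionRing K[X]) q]
    have : algebraMap K[X] (FractionRing K[X]) (q : K[X]) ≠ 0 := by
      simpa using hq0
    exact mul_div_cancel₀ _ this
  have hfS : f ∈ S := mem_fractionPolynomials_of_mul_eq p.2 q.2 (by simpa using hq0) hqf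
  refine ⟨⟨f, hfS⟩, ?_⟩
  have hq1 : algebraMap S (FractionRing S) q ≠ 0 := by simpa using hq0
  rw [eq_div_iff hq1, ← map_mul]
  congr 1
  ext1
  rw [← hqf]
  exact mul_comm _ _

theorem coeff_coeff_swap {K : Type*} [Field K] (p : K[X][X]) (i j : ℕ) :
    ((Bivariate.swap p).coeff i).coeff j = (p.coeff j).coeff i := by
  induction p using Polynomial.induction_on' with
  | add p q hp hq => simp [hp, hq]
  | monomial n f =>
    induction f using Polynomial.induction_on' with
    | add p q hp hq => simp only [map_add, coeff_add, hp, hq]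
    | monomial m r =>
      rw [Bivariate.swap_monomial_monomial]
      simp only [coeff_monomial]
      split_ifs <;> simp_all [coeff_monomial]

/-- If `m(T, X)` divides `z(T) - z(X)` and some coefficient of a power of `T` in `m` has
`X`-degree at least the degree of `z`, then the two have the same degree in `T`. -/
theorem natDegree_eq_of_mul_eq_map_sub_C {K : Type*} [Field K] {m q : K[X][X]} {z : K[X]}
    (hz : 0 < z.natDegree) (h : z.map C - C z = m * q) (k : ℕ)
    (hk : z.natDegree ≤ (m.coeff k).natDegree) : m.natDegree = z.natDegree := by
  have hs : C z - z.map C = Bivariate.swap m * Bivariate.swap q := by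
    rw [← map_mul, ← h, map_sub, Bivariate.swap_C, Bivariate.swap_map_C]
  have hz0 : z ≠ 0 := by rintro rfl; simp at hz
  have hdeg : (C z - z.map C).natDegree = z.natDegree := by
    rw [natDegree_sub_eq_right_of_natDegree_lt] <;> simp [hz]
  have hdeg' : (z.map C - C z).natDegree = z.natDegree := by
    rw [natDegree_sub_eq_left_of_natDegree_lt] <;> simp [hz]
  have hne : C z - z.map C ≠ 0 := by
    intro h0
    rw [h0] at hdeg
    simp at hdeg
    omega
  have hm0 : Bivariate.swap m ≠ 0 := fun h0 => hne (by rw [hs, h0, zero_mul])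
  have hq0 : Bivariate.swap q ≠ 0 := fun h0 => hne (by rw [hs, h0, mul_zero])
  have hsm : z.natDegree ≤ (Bivariate.swap m).natDegree := by
    refine hk.trans (le_natDegree_of_ne_zero fun h0 => ?_)
    have h1 := coeff_coeff_swap m (m.coeff k).natDegree k
    rw [h0, coeff_zero, coeff_natDegree, eq_comm, leadingCoeff_eq_zero] at h1
    rw [h1] at hk
    simp at hk
    omega
  have hq1 : (Bivariate.swap q).natDegree = 0 := by
    have h1 := natDegree_mul hm0 hq0
    rw [← hs, hdeg] at h1
    omega
  obtain ⟨q₀, hq₀⟩ := natDegree_eq_zero.mp hq1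
  have hlc : (C z - z.map C).leadingCoeff = - C z.leadingCoeff := by
    rw [leadingCoeff_sub_of_degree_lt']
    · simp
    · rw [degree_map_eq_of_injective C_injective]
      exact degree_C_le.trans_lt (natDegree_pos_iff_degree_pos.mp hz)
  have hunit : IsUnit q₀ := by
    refine isUnit_of_dvd_unit (?_ : q₀ ∣ C z.leadingCoeff)
      (isUnit_C.mpr (IsUnit.mk0 _ (leadingCoeff_ne_zero.mpr hz0)))
    rw [← dvd_neg, ← hlc, hs, ← hq₀, leadingCoeff_mul, leadingCoeff_C]
    exact dvd_mul_left _ _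
  obtain ⟨u, hu, rfl⟩ := isUnit_iff.mp hunit
  have hq : q = C (C u) := by
    rw [← Bivariate.swap_swap_apply q, ← hq₀, Bivariate.swap_C_C]
  rw [← hdeg', h, hq, natDegree_mul_C (by simpa using hu.ne_zero)]

theorem monic_map_sub_C {K S : Type*} [Field K] [CommRing S] [Algebra K S] {z : K[X]}
    (hz : z.Monic) (hd : 0 < z.natDegree) (s : S) :
    (z.map (algebraMap K S) - C s).Monic := by
  nontriviality S
  refine (hz.map _).sub_of_left ?_
  rw [hz.degree_map]
  exact degree_C_le.trans_lt (natDegree_pos_iff_degree_pos.mp hd)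

theorem exists_generator_of_nonconstant {K : Type*} [Field K] (R : Subalgebra K K[X]) {f₀ : K[X]}
    (hf₀ : f₀ ∈ R) (hd : 0 < f₀.natDegree) :
    ∃ z ∈ fractionPolynomials R, R ≤ Algebra.adjoin K {z} := by
  let S := fractionPolynomials R
  have hS : IsIntegrallyClosed S := isIntegrallyClosed_fractionPolynomials R
  have hnormal : ∀ f ∈ S, 0 < f.natDegree → ∃ g ∈ S, g.Monic ∧ g.natDegree = f.natDegree := by
    intro f hf hfd
    have hf0 : f ≠ 0 := by rintro rfl; simp at hfd
    exact ⟨f * C f.leadingCoeff⁻¹, S.mul_mem hf (S.algebraMap_mem _),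
      monic_mul_leadingCoeff_inv hf0,
      natDegree_mul_C (inv_ne_zero (leadingCoeff_ne_zero.mpr hf0))⟩
  have hroot : ∀ (T : Subalgebra K K[X]) (f : T),
      aeval (X : K[X]) ((f : K[X]).map (algebraMap K T) - C f) = 0 := by
    intro T f
    rw [aeval_def, eval₂_sub, eval₂_C, ← aeval_def, aeval_map_algebraMap, aeval_X_left_apply]
    exact sub_self _
  obtain ⟨f₁, hf₁, hmon₁, hd₁⟩ := hnormal f₀ (le_fractionPolynomials R hf₀) hd
  have hint : IsIntegral S (X : K[X]) :=
    ⟨_, monic_map_sub_C hmon₁ (hd₁ ▸ hd) (⟨f₁, hf₁⟩ : S), hroot S ⟨f₁, hf₁⟩⟩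
  set m := minpoly S (X : K[X]) with hm
  have hmm : m.Monic := minpoly.monic hint
  have hinj : Function.Injective (algebraMap S K[X]) := Subtype.val_injective
  obtain ⟨k, hk⟩ : ∃ k, 0 < (m.coeff k : K[X]).natDegree := by
    by_contra! hcon
    have h1 : m.map (algebraMap S K[X]) =
        ((m.map (algebraMap S K[X])).map (evalRingHom 0)).map C := by
      ext1 k
      have := eq_C_of_natDegree_le_zero (hcon k)
      simp only [coeff_map, coe_evalRingHom, ← coeff_zero_eq_eval_zero]
      exact this
    have h2 : aeval (X : K[X]) m = 0 := minpoly.aeval _ _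
    rw [← eval_map_algebraMap, h1, eval_map, eval₂_C_X] at h2
    rw [h2, Polynomial.map_zero] at h1
    exact (hmm.map (algebraMap S K[X])).ne_zero h1
  have hdvd : ∀ {p : S[X]}, aeval (X : K[X]) p = 0 → m ∣ p :=
    fun h => minpoly.isIntegrallyClosed_dvd hint h
  have hdeg : m.natDegree = (m.coeff k : K[X]).natDegree := by
    obtain ⟨q, hq⟩ := hdvd (hroot S (m.coeff k))
    have h1 := congrArg (Polynomial.map (algebraMap S K[X])) hq
    rw [Polynomial.map_sub, Polynomial.map_mul, Polynomial.map_map, map_C,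
      ← IsScalarTower.algebraMap_eq] at h1
    have h2 := natDegree_eq_of_mul_eq_map_sub_C hk h1 k (by rw [coeff_map]; exact le_rfl)
    rwa [natDegree_map_eq_of_injective hinj] at h2
  obtain ⟨z, hzS, hzm, hzd⟩ := hnormal _ (m.coeff k).2 hk
  refine ⟨z, hzS, fun f hf => ?_⟩
  let T := Algebra.adjoin K {z}
  have hTS : T ≤ S := Algebra.adjoin_le (by simpa using hzS)
  let zT : T := ⟨z, Algebra.self_mem_adjoin_singleton K z⟩
  let P : T[X] := z.map (algebraMap K T) - C zT
  have hP : P.Monic := monic_map_sub_C hzm (hzd ▸ hk) zT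
  let r := (f.map (algebraMap K T)) %ₘ P
  have hr : aeval (X : K[X]) r = f := by
    have h1 := congrArg (aeval (X : K[X])) (modByMonic_add_div (f.map (algebraMap K T)) P)
    rw [map_add, map_mul, hroot T zT, zero_mul, add_zero, aeval_map_algebraMap,
      aeval_X_left_apply] at h1
    exact h1
  have hrd : r.natDegree < m.natDegree := by
    have hPd : P.natDegree = z.natDegree := by
      simp only [P]
      rw [natDegree_sub_C, natDegree_map_eq_of_injective (algebraMap K T).injective]
    rw [hdeg, ← hzd, ← hPd]
    exact natDegree_modByMonic_lt _ hP (fun h => by rw [h] at hPd; simp at hPd; omega)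
  let fS : S := ⟨f, le_fractionPolynomials R hf⟩
  let r' : S[X] := r.map (Subalgebra.inclusion hTS : T →+* S)
  have hr' : aeval (X : K[X]) (r' - C fS) = 0 := by
    have : aeval (X : K[X]) r' = aeval (X : K[X]) r := by
      simp only [r', aeval_def, eval₂_map]
      rfl
    rw [aeval_def, eval₂_sub, eval₂_C, ← aeval_def, this, hr]
    exact sub_self _
  have hzero : r' - C fS = 0 := by
    refine eq_zero_of_dvd_of_natDegree_lt (hdvd hr') ?_
    rw [natDegree_sub_C]
    exact natDegree_map_le.trans_lt hrd
  have h0 := congrArg (fun p : S[X] => (p.coeff 0 : K[X])) (sub_eq_zero.mp hzero)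
  simp only [r', coeff_map, coeff_C_zero] at h0
  change ((r.coeff 0 : T) : K[X]) = f at h0
  rw [← h0]
  exact (r.coeff 0).2

theorem AlgHom.exists_factorization_of_injective {F A B D : Type*} [CommRing F] [CommRing A]
    [CommRing B] [CommRing D] [Algebra F A] [Algebra F B] [Algebra F D] (e : B →ₐ[F] D)
    (he : Function.Injective e) (ψ : A →ₐ[F] D) (h : ∀ a, ∃ b, e b = ψ a) :
    ∃ ψ' : A →ₐ[F] B, ∀ a, e (ψ' a) = ψ a :=
  ⟨(AlgEquiv.ofInjective e he).symm.toAlgHom.comp (ψ.codRestrict e.range h), fun a =>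
    congrArg Subtype.val ((AlgEquiv.ofInjective e he).apply_symm_apply ⟨ψ a, h a⟩)⟩

theorem natDegree_pos_of_aeval {K L : Type*} [Field K] [Field L] [Algebra L K] {z : K[X]}
    {f : L[X]} (h : 0 < (aeval z f).natDegree) : 0 < f.natDegree := by
  by_contra hcon
  rw [eq_C_of_natDegree_eq_zero (Nat.eq_zero_of_not_pos hcon), aeval_C,
    IsScalarTower.algebraMap_apply L K K[X], algebraMap_eq, natDegree_C] at h
  exact lt_irrefl _ h

theorem transcendental_of_natDegree_pos {L B : Type*} [CommRing L] [CommRing B] [IsDomain B]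
    [Algebra L B] (hL : Function.Injective (algebraMap L B)) {z : B[X]}
    (h : 0 < z.natDegree) : Transcendental L z := by
  refine Transcendental.restrictScalars (S := B) hL (Polynomial.transcendental z h.ne' ?_)
  refine mem_nonZeroDivisors_of_ne_zero (leadingCoeff_ne_zero.mpr ?_)
  rintro rfl
  simp at h

theorem aeval_injective_of_natDegree_pos {K L : Type*} [Field K] [Field L] [Algebra L K] {z : K[X]}
    (h : 0 < z.natDegree) : Function.Injective (aeval z : L[X] →ₐ[L] K[X]) :=
  transcendental_iff_injective.mp
    (transcendental_of_natDegree_pos (algebraMap L K).injective h)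

theorem exists_algHom_generating_X {F A K : Type*} [Field F] [CommRing A] [Algebra F A]
    [Field K] [Algebra F K] (ψ : A →ₐ[F] K[X]) {a₀ : A} (ha₀ : 0 < (ψ a₀).natDegree) :
    ∃ ψ' : A →ₐ[F] K[X], 0 < (ψ' a₀).natDegree ∧
      X ∈ fractionPolynomials (Algebra.adjoin K (Set.range ψ')) := by
  obtain ⟨z, ⟨b, hb, hb0, hbz⟩, hR⟩ := exists_generator_of_nonconstant
    (Algebra.adjoin K (Set.range ψ)) (Algebra.subset_adjoin ⟨a₀, rfl⟩) ha₀
  have hrange : ∀ f ∈ Algebra.adjoin K (Set.range ψ), ∃ g : K[X], aeval z g = f := by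
    intro f hf
    have := hR hf
    rwa [Algebra.adjoin_singleton_eq_range_aeval] at this
  have hz : 0 < z.natDegree := by
    obtain ⟨g, hg⟩ := hrange _ (Algebra.subset_adjoin ⟨a₀, rfl⟩)
    by_contra hcon
    rw [← hg, eq_C_of_natDegree_eq_zero (Nat.eq_zero_of_not_pos hcon), ← algebraMap_eq,
      aeval_algebraMap_apply, algebraMap_eq, natDegree_C] at ha₀
    exact lt_irrefl _ ha₀
  have hinj := aeval_injective_of_natDegree_pos (L := K) hz
  obtain ⟨ψ', hψ'⟩ := AlgHom.exists_factorization_of_injective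
    ((aeval z : K[X] →ₐ[K] K[X]).restrictScalars F) hinj ψ
    fun a => hrange _ (Algebra.subset_adjoin ⟨a, rfl⟩)
  have hmap : (Algebra.adjoin K (Set.range ψ')).map (aeval z) = Algebra.adjoin K (Set.range ψ) := by
    rw [AlgHom.map_adjoin, ← Set.range_comp]
    congr 2
    exact funext hψ'
  refine ⟨ψ', natDegree_pos_of_aeval (z := z) (L := K) (by rw [← hψ' a₀] at ha₀; exact ha₀), ?_⟩
  rw [← hmap] at hb hbz
  obtain ⟨b', hb', rfl⟩ := hb
  obtain ⟨c, hc, hcb⟩ := hbz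
  refine ⟨b', hb', fun h => hb0 (by simp [h]), ?_⟩
  have : b' * X = c := hinj (by rw [map_mul, aeval_X]; exact hcb.symm)
  rwa [this]

theorem exists_natDegree_sum_eq_one {K G : Type*} [Field K] [Fintype G] [Nonempty G]
    (τ : G → K →* K) (hτ : Function.Injective τ) (x : G → K[X])
    (hx : ∀ σ, (x σ).natDegree = 1) : ∃ c, (∑ σ, C (τ σ c) * x σ).natDegree = 1 := by
  have hli := (linearIndependent_monoidHom K K).comp τ hτ
  rw [Fintype.linearIndependent_iff] at hli
  obtain ⟨σ₀⟩ := ‹Nonempty G›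
  obtain ⟨c, hc⟩ : ∃ c, ∑ σ, (x σ).coeff 1 * τ σ c ≠ 0 := by
    by_contra! hcon
    have h := hli (fun σ => (x σ).coeff 1) (funext fun c => by simpa using hcon c) σ₀
    rw [← hx σ₀, coeff_natDegree, leadingCoeff_eq_zero] at h
    simpa [h] using hx σ₀
  refine ⟨c, natDegree_eq_of_le_of_coeff_ne_zero ?_ ?_⟩
  · refine natDegree_sum_le_of_forall_le _ _ fun σ _ => ?_
    exact (natDegree_C_mul_le _ _).trans (hx σ).le
  · simp only [finsetSum_coeff, coeff_C_mul]
    simpa only [mul_comm] using hc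

section SemilinearAutomorphisms

variable {F K : Type*} [Field F] [Field K] [Algebra F K] [Normal F K]

theorem apply_algebraMap_fractionRing (σ : FractionRing K[X] ≃ₐ[F] FractionRing K[X]) {x : K[X]}
    (hx : σ (algebraMap K[X] _ X) = algebraMap K[X] _ x) (f : K[X]) :
    σ (algebraMap K[X] _ f) =
      algebraMap K[X] _ ((f.map (σ.restrictNormal K : K →+* K)).comp x) := by
  have h : (σ : FractionRing K[X] →+* FractionRing K[X]).comp (algebraMap K[X] _) =
      (algebraMap K[X] _).comp
        ((compRingHom x).comp (mapRingHom (σ.restrictNormal K : K →+* K))) := by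
    refine ringHom_ext (fun a => ?_) ?_
    · have := (σ.restrictNormal_commutes K a).symm
      rw [IsScalarTower.algebraMap_apply K K[X] (FractionRing K[X]),
        IsScalarTower.algebraMap_apply K K[X] (FractionRing K[X])] at this
      simpa using this
    · simpa using hx
  exact RingHom.congr_fun h f

theorem exists_apply_algebraMap_X (σ : FractionRing K[X] ≃ₐ[F] FractionRing K[X]) {p q : K[X]}
    (hp : 0 < p.natDegree) (hpq : σ (algebraMap K[X] _ p) = algebraMap K[X] _ q) :
    ∃ x, σ (algebraMap K[X] _ X) = algebraMap K[X] _ x := by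
  have hp0 : p ≠ 0 := by rintro rfl; simp at hp
  set τ : K →+* K := (σ.restrictNormal K : K →+* K) with hτ
  have hC : ∀ a : K, σ (algebraMap K[X] _ (C a)) = algebraMap K[X] _ (C (τ a)) := by
    intro a
    have := (σ.restrictNormal_commutes K a).symm
    rwa [IsScalarTower.algebraMap_apply K K[X] (FractionRing K[X]),
      IsScalarTower.algebraMap_apply K K[X] (FractionRing K[X])] at this
  suffices IsIntegral K[X] (σ (algebraMap K[X] (FractionRing K[X]) X)) by
    obtain ⟨x, hx⟩ := IsIntegrallyClosed.isIntegral_iff.mp this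
    exact ⟨x, hx.symm⟩
  set p₁ := p * C p.leadingCoeff⁻¹ with hp₁
  have hp₁m : p₁.Monic := monic_mul_leadingCoeff_inv hp0
  have hp₁d : 0 < p₁.natDegree := by
    rwa [hp₁, natDegree_mul_C (inv_ne_zero (leadingCoeff_ne_zero.mpr hp0))]
  refine ⟨(p₁.map τ).map (algebraMap K K[X]) - C (q * C (τ p.leadingCoeff⁻¹)),
    monic_map_sub_C (hp₁m.map _) (by rwa [natDegree_map]) _, ?_⟩
  have h1 : eval₂ (algebraMap K[X] (FractionRing K[X])) (σ (algebraMap K[X] _ X))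
      ((p₁.map τ).map (algebraMap K K[X])) = σ (algebraMap K[X] _ p₁) := by
    have h : (eval₂RingHom (algebraMap K[X] (FractionRing K[X])) (σ (algebraMap K[X] _ X))).comp
        ((mapRingHom (algebraMap K K[X])).comp (mapRingHom τ)) =
        (σ : FractionRing K[X] →+* FractionRing K[X]).comp (algebraMap K[X] _) := by
      refine ringHom_ext (fun a => ?_) ?_
      · simpa using (hC a).symm
      · simp
    exact RingHom.congr_fun h p₁
  rw [eval₂_sub, h1, eval₂_C, hp₁, map_mul, map_mul, hpq, hC, map_mul, sub_self]

theorem natDegree_apply_algebraMap_X (σ : FractionRing K[X] ≃ₐ[F] FractionRing K[X]) {x y : K[X]}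
    (hx : σ (algebraMap K[X] _ X) = algebraMap K[X] _ x)
    (hy : σ.symm (algebraMap K[X] _ X) = algebraMap K[X] _ y) : x.natDegree = 1 := by
  have h1 := apply_algebraMap_fractionRing σ hx y
  rw [← hy, σ.apply_symm_apply] at h1
  have h2 := congrArg natDegree (IsFractionRing.injective K[X] (FractionRing K[X]) h1)
  rw [natDegree_X, natDegree_comp] at h2
  exact Nat.eq_one_of_mul_eq_one_left h2.symm

end SemilinearAutomorphisms

/-- Galois descent for the affine line: if `K / F` is finite Galois and the
image of `A → K[X]` generates `K(X)` together with `K`, then the polynomials over `K` lying in the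
field of fractions of the image of `A` form a polynomial ring `L[Y]`. -/
theorem exists_algHom_polynomial_birational {F A K : Type*} [Field F] [CommRing A] [Algebra F A]
    [Field K] [Algebra F K] [IsGalois F K] [FiniteDimensional F K] (ψ : A →ₐ[F] K[X]) {a₀ : A}
    (ha₀ : 0 < (ψ a₀).natDegree)
    (hX : X ∈ fractionPolynomials (Algebra.adjoin K (Set.range ψ))) :
    ∃ (L : IntermediateField F K) (i : A →ₐ[F] L[X]), 0 < (i a₀).natDegree ∧
      ∀ f : L[X], ∃ p q : A, i q ≠ 0 ∧ i q * f = i p := by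
  let Q := FractionRing K[X]
  let ι : K[X] →ₐ[F] Q := IsScalarTower.toAlgHom F K[X] Q
  have hι : Function.Injective ι := IsFractionRing.injective K[X] Q
  let κ : K →ₐ[F] Q := IsScalarTower.toAlgHom F K Q
  have hκ : ∀ a, κ a = ι (C a) := fun a => IsScalarTower.algebraMap_apply K K[X] Q a
  let E : IntermediateField F Q := IntermediateField.adjoin F (Set.range (ι.comp ψ))
  have hψE : ∀ a, ι (ψ a) ∈ E := fun a => IntermediateField.subset_adjoin F _ ⟨a, rfl⟩
  have htop : κ.fieldRange ⊔ E = ⊤ := by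
    set M := κ.fieldRange ⊔ E
    have hKM : ∀ a, ι (C a) ∈ M := fun a =>
      (le_sup_left : κ.fieldRange ≤ M) ⟨a, hκ a⟩
    have hRM : ∀ f ∈ Algebra.adjoin K (Set.range ψ), ι f ∈ M := by
      intro f hf
      induction hf using Algebra.adjoin_induction with
      | mem x hx =>
        obtain ⟨a, rfl⟩ := hx
        exact (le_sup_right : E ≤ M) (hψE a)
      | algebraMap r => exact hKM r
      | add x y _ _ hx hy => rw [map_add]; exact M.add_mem hx hy
      | mul x y _ _ hx hy => rw [map_mul]; exact M.mul_mem hx hy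
    have hXM : ι X ∈ M := by
      obtain ⟨b, hb, hb0, hbX⟩ := hX
      have hb1 : ι b ≠ 0 := fun h => hb0 (hι (h.trans (map_zero ι).symm))
      have : ι X = ι (b * X) / ι b := by rw [map_mul, mul_div_cancel_left₀ _ hb1]
      rw [this]
      exact M.div_mem (hRM _ hbX) (hRM _ hb)
    have hpM : ∀ f : K[X], ι f ∈ M := by
      intro f
      induction f using Polynomial.induction_on with
      | C a => exact hKM a
      | add p q hp hq => rw [map_add]; exact M.add_mem hp hq
      | monomial n a h =>
        rw [pow_succ, ← mul_assoc, map_mul]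
        exact M.mul_mem h hXM
    rw [eq_top_iff]
    intro x _
    obtain ⟨p, q, -, rfl⟩ := IsFractionRing.div_surjective (A := K[X]) x
    exact M.div_mem (hpM p) (hpM q)
  have hG₁ : IsGalois F κ.fieldRange :=
    IsGalois.of_algEquiv (AlgEquiv.ofInjectiveField κ)
  have hfin₁ : FiniteDimensional F κ.fieldRange :=
    (AlgEquiv.ofInjectiveField κ).toLinearEquiv.finiteDimensional
  have hGal : IsGalois E Q := IsGalois.sup_right κ.fieldRange E htop
  let G := Q ≃ₐ[E] Q
  let τ : G → (K ≃ₐ[F] K) := fun σ => (σ.restrictScalars F).restrictNormal K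
  have hτ : ∀ (σ : G) (a : K), σ (ι (C a)) = ι (C (τ σ a)) := by
    intro σ a
    rw [← hκ, ← hκ]
    exact ((σ.restrictScalars F).restrictNormal_commutes K a).symm
  have hfix : ∀ (σ : G), ∀ e ∈ E, σ e = e := fun σ e he => σ.commutes ⟨e, he⟩
  have hτinj : Function.Injective τ := by
    intro σ₁ σ₂ h
    let M : IntermediateField F Q :=
      { AlgHom.equalizer (σ₁.restrictScalars F : Q →ₐ[F] Q) (σ₂.restrictScalars F) with
        inv_mem' := fun q (hq : σ₁ q = σ₂ q) => show σ₁ q⁻¹ = σ₂ q⁻¹ by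
          rw [map_inv₀, map_inv₀, hq] }
    have hM : κ.fieldRange ⊔ E ≤ M := by
      refine sup_le ?_ fun e he => (hfix σ₁ e he).trans (hfix σ₂ e he).symm
      rintro _ ⟨a, rfl⟩
      change σ₁ (κ a) = σ₂ (κ a)
      rw [hκ, hτ, hτ, h]
    exact AlgEquiv.ext fun q => hM (htop ▸ IntermediateField.mem_top : q ∈ κ.fieldRange ⊔ E)
  have hGfin : Finite G := Finite.of_injective τ hτinj
  have := Fintype.ofFinite G
  have hx : ∀ σ : G, ∃ x : K[X], σ (ι X) = ι x := fun σ =>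
    exists_apply_algebraMap_X (σ.restrictScalars F) ha₀ (hfix σ _ (hψE a₀))
  choose x hx using hx
  have hσ : ∀ (σ : G) (f : K[X]), σ (ι f) = ι ((f.map (τ σ : K →+* K)).comp (x σ)) :=
    fun σ f => apply_algebraMap_fractionRing (σ.restrictScalars F) (hx σ) f
  have hx1 : ∀ σ : G, (x σ).natDegree = 1 := fun σ =>
    natDegree_apply_algebraMap_X (σ.restrictScalars F) (hx σ) (hx σ⁻¹)
  have hmem : ∀ q : Q, q ∈ E ↔ ∀ σ : G, σ q = q := by
    intro q
    refine ⟨fun h σ => hfix σ q h, fun h => ?_⟩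
    obtain ⟨e, rfl⟩ := IntermediateField.mem_bot.mp ((InfiniteGalois.mem_bot_iff_fixed q).mpr h)
    exact e.2
  obtain ⟨c, hc⟩ := exists_natDegree_sum_eq_one (fun σ : G => (τ σ : K →* K))
    (fun σ₁ σ₂ h => hτinj (AlgEquiv.ext fun a => DFunLike.congr_fun h a)) x hx1
  set y : K[X] := ∑ σ : G, C (τ σ c) * x σ with hy
  have hyd : y.natDegree = 1 := hc
  have hyE : ι y ∈ E := by
    rw [hmem]
    have hy' : ι y = ∑ σ : G, σ (ι (C c * X)) := by
      rw [hy, map_sum]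
      exact Finset.sum_congr rfl fun σ _ => by rw [map_mul, map_mul, map_mul, hτ, hx]
    intro σ
    rw [hy', map_sum]
    exact Fintype.sum_equiv (Equiv.mulLeft σ) _ _ fun ρ => rfl
  let L : IntermediateField F K := E.comap κ
  have hL : ∀ a : K, a ∈ L ↔ ι (C a) ∈ E := fun a => by
    rw [← hκ]
    rfl
  have hinj : Function.Injective (aeval y : L[X] →ₐ[L] K[X]) :=
    aeval_injective_of_natDegree_pos (hyd ▸ one_pos)
  have haeval : ∀ g : L[X], aeval y g = (g.map (algebraMap L K)).comp y := fun g => by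
    rw [comp, eval₂_map, aeval_def]
    rfl
  have hsurj : ∀ f : K[X], ι f ∈ E → ∃ g : L[X], aeval y g = f := by
    intro f hf
    obtain ⟨u, hu, v, huv⟩ := natDegree_eq_one.mp hyd
    obtain ⟨g, hgy⟩ : ∃ g : K[X], g.comp y = f := by
      refine ⟨f.comp (C u⁻¹ * (X - C v)), ?_⟩
      have : (C u⁻¹ * (X - C v)).comp (C u * X + C v) = X := by
        simp [← mul_assoc, ← C_mul, inv_mul_cancel₀ hu]
      rw [comp_assoc, ← huv, this, comp_X]
    have hg : g ∈ lifts (algebraMap L K) := by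
      rw [lifts_iff_coeff_lifts]
      intro k
      suffices g.coeff k ∈ L from ⟨⟨_, this⟩, rfl⟩
      rw [hL, hmem]
      intro σ
      have h1 : ι ((g.map (τ σ : K →+* K)).comp y) = ι (g.comp y) := by
        have hy1 := hfix σ _ hyE
        have hf1 := hfix σ _ hf
        rw [hσ] at hy1 hf1
        rw [← hgy, Polynomial.map_comp, comp_assoc, hι hy1] at hf1
        exact hf1
      have h2 : g.map (τ σ : K →+* K) = g :=
        aeval_injective_of_natDegree_pos (L := K) (hyd ▸ one_pos : 0 < y.natDegree) (hι h1)
      rw [hτ]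
      conv_rhs => rw [← h2]
      rw [coeff_map]
      rfl
    obtain ⟨g', hg'⟩ := (mem_lifts _).mp hg
    exact ⟨g', by rw [haeval, hg', hgy]⟩
  obtain ⟨i, hi⟩ := AlgHom.exists_factorization_of_injective
    ((aeval y : L[X] →ₐ[L] K[X]).restrictScalars F) hinj ψ fun a => hsurj _ (hψE a)
  change ∀ a, aeval y (i a) = ψ a at hi
  refine ⟨L, i, natDegree_pos_of_aeval (z := y) (by rwa [hi]), fun f => ?_⟩
  have hfE : ι (aeval y f) ∈ E := by
    induction f using Polynomial.induction_on with
    | C a =>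
      rw [aeval_C]
      exact (hL _).mp a.2
    | add p q hp hq => rw [map_add, map_add]; exact E.add_mem hp hq
    | monomial n a h =>
      rw [pow_succ, ← mul_assoc, map_mul, map_mul, aeval_X]
      exact E.mul_mem h hyE
  obtain ⟨r, hr, s, hs, hrs⟩ := IntermediateField.mem_adjoin_iff_div.mp hfE
  rw [← AlgHom.coe_range, Algebra.adjoin_eq] at hr hs
  obtain ⟨p, rfl⟩ := hr
  obtain ⟨q, rfl⟩ := hs
  have hi0 : ∀ a, i a = 0 ↔ ψ a = 0 := fun a => by
    rw [← hi, map_eq_zero_iff _ hinj]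
  by_cases hq : ψ q = 0
  · refine ⟨0, 1, by simp, ?_⟩
    have : ι (aeval y f) = 0 := by
      rw [hrs]
      simp [hq]
    rw [map_eq_zero_iff _ hι, map_eq_zero_iff _ hinj] at this
    simp [this]
  · refine ⟨p, q, fun h => hq ((hi0 q).mp h), hinj (hι ?_)⟩
    have hq' : ι (ψ q) ≠ 0 := fun h => hq ((map_eq_zero_iff _ hι).mp h)
    rw [map_mul, map_mul, hi, hi, hrs]
    exact mul_div_cancel₀ _ hq'

theorem TrdegOne.isAlgebraic_adjoin {F A : Type*} [Field F] [CommRing A] [IsDomain A]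
    [Algebra F A] (htr : TrdegOne F A) {a : A} (ha : Transcendental F a) :
    Algebra.IsAlgebraic (Algebra.adjoin F {a}) A := by
  obtain ⟨x, hx⟩ := htr
  have h1 := hx.lift_cardinalMk_eq_trdeg
  have h2 : AlgebraicIndependent F (fun _ : Unit => a) :=
    (algebraicIndependent_unique_type_iff (ι := Unit)).mpr ha
  have h3 := h2.isTranscendenceBasis_of_lift_trdeg_le_of_finite h1.symm.le
  have h4 := h3.isAlgebraic
  rwa [Set.range_const] at h4

theorem exists_isGalois_nonconstant {F A : Type*} {B : Type u} [Field F] [PerfectField F]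
    [CommRing A] [Algebra F A] [CommRing B] [IsDomain B] [Algebra F B] [Algebra.FiniteType F B]
    (φ : A →ₐ[F] B[X]) {a : A} (ha : 0 < (φ a).natDegree) :
    ∃ (K : Type u) (_ : Field K) (_ : Algebra F K) (ψ : A →ₐ[F] K[X]),
      IsGalois F K ∧ FiniteDimensional F K ∧ 0 < (ψ a).natDegree := by
  have hb : (φ a).leadingCoeff ≠ 0 := leadingCoeff_ne_zero.mpr fun h => by simp [h] at ha
  have : IsJacobsonRing B := isJacobsonRing_of_finiteType (A := F)
  have hJ : (⊥ : Ideal B).jacobson = ⊥ :=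
    IsJacobsonRing.out ‹_› Ideal.isPrime_bot.isRadical
  obtain ⟨m, hm, hbm⟩ : ∃ m : Ideal B, m.IsMaximal ∧ (φ a).leadingCoeff ∉ m := by
    by_contra! hcon
    refine hb ?_
    rw [← Ideal.mem_bot, ← hJ, Ideal.jacobson, Ideal.mem_sInf]
    exact fun {m} hm => hcon m hm.2
  let _ : Field (B ⧸ m) := Ideal.Quotient.field m
  have : Module.Finite F (B ⧸ m) := finite_of_finite_type_of_isJacobsonRing F (B ⧸ m)
  let Ω := AlgebraicClosure (B ⧸ m)
  have : Algebra.IsAlgebraic F Ω := Algebra.IsAlgebraic.trans F (B ⧸ m) Ω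
  have : Normal F Ω := by
    have : IsAlgClosure F Ω := ⟨inferInstance, inferInstance⟩
    exact IsAlgClosure.normal F Ω
  let K := IntermediateField.normalClosure F (B ⧸ m) Ω
  let g : B →ₐ[F] K := ((IsScalarTower.toAlgHom F (B ⧸ m) K).comp (Ideal.Quotient.mkₐ F m))
  refine ⟨K, inferInstance, inferInstance, (mapAlgHom g).comp φ, ?_,
    normalClosure.is_finiteDimensional F (B ⧸ m) Ω, ?_⟩
  · have : Normal F K := normalClosure.normal F (B ⧸ m) Ω
    exact { }
  · refine ha.trans_le (le_natDegree_of_ne_zero ?_)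
    change ((φ a).map (g : B →+* K)).coeff _ ≠ 0
    rw [coeff_map]
    change algebraMap (B ⧸ m) K (Ideal.Quotient.mk m (φ a).leadingCoeff) ≠ 0
    rwa [Ne, map_eq_zero, Ideal.Quotient.eq_zero_iff_mem]

theorem AlgHom.injective_of_transcendental {F A D : Type*} [Field F] [CommRing A] [IsDomain A]
    [Algebra F A] [CommRing D] [Algebra F D] (i : A →ₐ[F] D) {a : A}
    [Algebra.IsAlgebraic (Algebra.adjoin F {a}) A] (ha : Transcendental F (i a)) :
    Function.Injective i := by
  rw [injective_iff_map_eq_zero]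
  intro x hx
  by_contra hx0
  have h := Ideal.comap_ne_bot_of_algebraic_mem (I := RingHom.ker i) hx0 hx
    (Algebra.IsAlgebraic.isAlgebraic (R := Algebra.adjoin F {a}) x)
  refine h (le_bot_iff.mp ?_)
  rintro ⟨y, hy⟩ (hy0 : i y = 0)
  rw [Algebra.adjoin_singleton_eq_range_aeval] at hy
  obtain ⟨p, rfl⟩ := hy
  change i (aeval a p) = 0 at hy0
  rw [← aeval_algHom_apply] at hy0
  have hp := (transcendental_iff.mp ha) p hy0
  exact Subtype.ext (by simp [hp])

theorem exists_birational_algHom_polynomial {F A : Type*} {B : Type u} [Field F] [PerfectField F]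
    [CommRing A] [Algebra F A] [CommRing B] [IsDomain B] [Algebra F B] [Algebra.FiniteType F B]
    (φ : A →ₐ[F] B[X]) {a : A} (ha : 0 < (φ a).natDegree) :
    ∃ (L : Type u) (_ : Field L) (_ : Algebra F L) (i : A →ₐ[F] L[X]),
      FiniteDimensional F L ∧ 0 < (i a).natDegree ∧
        ∀ f : L[X], ∃ p q : A, i q ≠ 0 ∧ i q * f = i p := by
  obtain ⟨K, _, _, ψ, _, _, hψ⟩ := exists_isGalois_nonconstant φ ha
  obtain ⟨ψ', hψ', hX⟩ := exists_algHom_generating_X ψ hψ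
  obtain ⟨L, i, hi, hi'⟩ := exists_algHom_polynomial_birational ψ' hψ' hX
  exact ⟨L, inferInstance, inferInstance, i, inferInstance, hi, hi'⟩

theorem AlgHom.isIntegral_of_natDegree_pos {F A L : Type*} [Field F] [CommRing A] [Algebra F A]
    [Field L] [Algebra F L] [FiniteDimensional F L] (i : A →ₐ[F] L[X]) {a : A}
    (ha : 0 < (i a).natDegree) : (i : A →+* L[X]).IsIntegral := by
  let _ := (i : A →+* L[X]).toAlgebra
  have hL : ∀ c : L, (i : A →+* L[X]).IsIntegralElem (C c) := by
    intro c
    obtain ⟨p, hp, hpc⟩ := Algebra.IsIntegral.isIntegral (R := F) c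
    refine ⟨p.map (algebraMap F A), hp.map _, ?_⟩
    rw [eval₂_map]
    have : (i : A →+* L[X]).comp (algebraMap F A) = C.comp (algebraMap F L) := by
      ext r; simp [IsScalarTower.algebraMap_apply F L L[X]]
    rw [this, ← hom_eval₂, hpc, map_zero]
  have hX : (i : A →+* L[X]).IsIntegralElem X := by
    have h0 : i a ≠ 0 := by rintro h; simp [h] at ha
    let S := integralClosure A L[X]
    let _ : Algebra L S := ((C : L →+* L[X]).codRestrict S hL).toAlgebra
    have hc : (i a).leadingCoeff⁻¹ ≠ 0 := inv_ne_zero (leadingCoeff_ne_zero.mpr h0)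
    set p := i a * C (i a).leadingCoeff⁻¹ with hp
    have hpS : p ∈ S := S.mul_mem isIntegral_algebraMap (hL _)
    have hpm : p.Monic := monic_mul_leadingCoeff_inv h0
    have hpd : 0 < p.natDegree := by rwa [hp, natDegree_mul_C hc]
    refine isIntegral_trans (A := S) X ⟨_, monic_map_sub_C hpm hpd (⟨p, hpS⟩ : S), ?_⟩
    have : (algebraMap S L[X]).comp (algebraMap L S) = C := RingHom.ext fun _ => rfl
    rw [eval₂_sub, eval₂_map, this, eval₂_C_X, eval₂_C]
    exact sub_self p
  intro f
  induction f using Polynomial.induction_on with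
  | C c => exact hL c
  | add p q hp hq => exact IsIntegral.add (R := A) hp hq
  | monomial n c h =>
    rw [pow_succ, ← mul_assoc]
    exact IsIntegral.mul (R := A) h hX

section Exponential

variable {k B : Type*} [CommRing k] [CommRing B] [Algebra k B] {φ : B →ₐ[k] B[X]}

theorem IsExponential.apply_eq_C (hφ : IsExponential φ) {b : B} (hb : (φ b).natDegree = 0) :
    φ b = C b := by
  have h := hφ.1 b
  rw [eq_C_of_natDegree_eq_zero hb, eval_C] at h
  rw [eq_C_of_natDegree_eq_zero hb, h]

theorem IsExponential.apply_leadingCoeff [IsDomain B] (hφ : IsExponential φ) (b : B) :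
    φ (φ b).leadingCoeff = C (φ b).leadingCoeff := by
  have h := congrArg (fun p => coeff p (φ b).natDegree) (hφ.2 b)
  have hcomp : (φ b).eval₂ ((C : B[X] →+* B[X][X]).comp (C : B →+* B[X])) (X + C X) =
      ((φ b).map C).comp (X + C X) := by
    rw [comp, eval₂_map]
  have hd : (((φ b).map C).comp (X + C X : B[X][X])).natDegree = (φ b).natDegree := by
    rw [natDegree_comp, natDegree_X_add_C, mul_one, natDegree_map_eq_of_injective C_injective]
  simp only [hcomp, coeff_map, coeff_natDegree] at h
  rw [← hd, coeff_natDegree, leadingCoeff_comp (by rw [natDegree_X_add_C]; exact one_ne_zero),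
    leadingCoeff_X_add_C, one_pow, mul_one, leadingCoeff_map_of_injective C_injective] at h
  exact h

theorem IsExponential.eval₂_neg_X (hφ : IsExponential φ) (b : B) :
    (φ b).eval₂ (φ : B →+* B[X]) (-X) = C b := by
  have h := congrArg (eval (-X)) (hφ.2 b)
  rw [eval_map, ← coe_evalRingHom, hom_eval₂, coe_evalRingHom, eval_add, eval_X, eval_C,
    neg_add_cancel] at h
  have hC : (evalRingHom (-X : B[X])).comp ((C : B[X] →+* B[X][X]).comp (C : B →+* B[X])) = C := by
    ext; simp
  rw [h, hC, ← map_zero C, eval₂_at_apply, hφ.1]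

end Exponential

section Extension

variable {B B' : Type*} [CommRing B] [CommRing B'] [IsDomain B'] {j : B →+* B'}

theorem RingHom.exists_extension_polynomial [UniqueFactorizationMonoid B']
    (hj : Function.Injective j) (hint : j.IsIntegral)
    (hbir : ∀ h : B', ∃ p q : B, j q ≠ 0 ∧ j q * h = j p) (φ : B →+* B[X])
    (hφ : Function.Injective φ) :
    ∃ Φ : B' →+* B'[X], ∀ b, Φ (j b) = (φ b).map j := by
  let _ := j.toAlgebra
  have htower : ∀ b, algebraMap B (FractionRing B') b = algebraMap B' _ (j b) :=
    fun b => IsScalarTower.algebraMap_apply B B' (FractionRing B') b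
  have hfrac : ∀ h : B', ∃ p q : B,
      algebraMap B' (FractionRing B') h = algebraMap B _ p / algebraMap B _ q := by
    intro h
    obtain ⟨p, q, hq, hpq⟩ := hbir h
    have hq' : algebraMap B' (FractionRing B') (j q) ≠ 0 :=
      (map_ne_zero_iff _ (IsFractionRing.injective B' _)).mpr hq
    refine ⟨p, q, ?_⟩
    rw [htower, htower, ← hpq, map_mul, mul_div_cancel_left₀ _ hq']
  have : IsFractionRing B (FractionRing B') := by
    have : FaithfulSMul B (FractionRing B') := by
      rw [faithfulSMul_iff_algebraMap_injective]
      intro a b hab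
      rw [htower, htower] at hab
      exact hj (IsFractionRing.injective B' (FractionRing B') hab)
    refine IsFractionRing.of_field _ _ fun z => ?_
    obtain ⟨x, y, -, rfl⟩ := IsFractionRing.div_surjective (A := B') z
    obtain ⟨p, q, hpq⟩ := hfrac x
    obtain ⟨p', q', hpq'⟩ := hfrac y
    exact ⟨p * q', q * p', by rw [hpq, hpq', map_mul, map_mul, div_div_div_eq]⟩
  let g : B →+* FractionRing B'[X] :=
    (algebraMap B'[X] (FractionRing B'[X])).comp ((mapRingHom j).comp φ)
  have hg : Function.Injective g := (IsFractionRing.injective B'[X] (FractionRing B'[X])).comp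
    ((map_injective j hj).comp hφ)
  let G : B' →+* FractionRing B'[X] :=
    (IsFractionRing.lift (K := FractionRing B') hg).comp (algebraMap B' (FractionRing B'))
  have hG : ∀ b, G (j b) = g b := fun b =>
    (congrArg _ (htower b).symm).trans (IsFractionRing.lift_algebraMap hg b)
  have hrange : ∀ h, G h ∈ (algebraMap B'[X] (FractionRing B'[X])).range := by
    intro h
    refine IsIntegrallyClosed.isIntegral_iff.mp ?_
    obtain ⟨p, hp, hph⟩ := hint h
    refine ⟨(p.map φ).map (mapRingHom j), (hp.map _).map _, ?_⟩
    rw [eval₂_map, eval₂_map]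
    have : ((algebraMap B'[X] (FractionRing B'[X])).comp (mapRingHom j)).comp φ = G.comp j :=
      RingHom.ext fun b => (hG b).symm
    rw [this, ← hom_eval₂, hph, map_zero]
  choose W hW using hrange
  have hinj := IsFractionRing.injective B'[X] (FractionRing B'[X])
  refine ⟨{ toFun := W
            map_one' := hinj (by simp [hW])
            map_zero' := hinj (by simp [hW])
            map_add' := fun _ _ => hinj (by simp [hW])
            map_mul' := fun _ _ => hinj (by simp [hW]) }, fun b => hinj ?_⟩
  exact (hW _).trans (hG b)

theorem IsExponential.coeff_mul_mem_range {k : Type*} [CommRing k] [Algebra k B]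
    {φ : B →ₐ[k] B[X]} (hφ : IsExponential φ) {Φ : B' →+* B'[X]}
    (hΦ : ∀ b, Φ (j b) = (φ b).map j)
    (hbir : ∀ h : B', ∃ p q : B, j q ≠ 0 ∧ j q * h = j p) {f : B}
    (hf : ∀ h, j f * h ∈ j.range) (n : ℕ) (h : B') : j ((φ f).coeff n) * h ∈ j.range := by
  have hΦC : ∀ h : B', (Φ h).eval₂ Φ (-X) = C h := by
    have h1 : ∀ b, (Φ (j b)).eval₂ Φ (-X) = C (j b) := by
      intro b
      have : Φ.comp j = (mapRingHom j).comp (φ : B →+* B[X]) := RingHom.ext hΦ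
      have h2 := congrArg (mapRingHom j) (hφ.eval₂_neg_X b)
      rw [hom_eval₂] at h2
      rw [hΦ, eval₂_map, this]
      simpa using h2
    intro h
    obtain ⟨p, q, hq, hpq⟩ := hbir h
    have h2 := h1 p
    rw [← hpq, map_mul, eval₂_mul, h1, C_mul] at h2
    exact mul_left_cancel₀ (C_ne_zero.mpr hq) h2
  have hmem : (φ f).map j * C h ∈ (mapRingHom j).range := by
    rw [← hΦC h, eval₂_eq_sum_range, Finset.mul_sum]
    refine sum_mem fun m _ => ?_
    rw [← mul_assoc]
    refine mul_mem ?_ (pow_mem (neg_mem (RingHom.mem_range.mpr ⟨X, by simp⟩)) _)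
    obtain ⟨b, hb⟩ := hf ((Φ h).coeff m)
    rw [← hΦ, ← map_mul, ← hb, hΦ]
    exact ⟨φ b, rfl⟩
  obtain ⟨p, hp⟩ := hmem
  have := congrArg (fun r => coeff r n) hp
  simp only [coe_mapRingHom, coeff_map, coeff_mul_C] at this
  exact ⟨_, this⟩

end Extension

section Conductor

variable {A N : Type*} [CommRing A] [CommRing N] {i : A →+* N}

/-- The conductor of a ring homomorphism `i : A → N`, the largest ideal of `N` contained in the
range of `i`. -/
def RingHom.conductor (i : A →+* N) : Ideal N where
  carrier := {f | ∀ h, f * h ∈ i.range}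
  add_mem' hf hg h := by
    rw [add_mul]
    exact add_mem (hf h) (hg h)
  zero_mem' h := by
    rw [zero_mul]
    exact zero_mem _
  smul_mem' c f hf h := by
    rw [smul_eq_mul, mul_comm c, mul_assoc]
    exact hf _

theorem RingHom.conductor_ne_bot [IsDomain N] (hfin : i.Finite)
    (hbir : ∀ h : N, ∃ p q : A, i q ≠ 0 ∧ i q * h = i p) : i.conductor ≠ ⊥ := by
  let _ := i.toAlgebra
  have : Module.Finite A N := hfin
  obtain ⟨s, hs⟩ := Module.Finite.fg_top (R := A) (M := N)
  choose p q hq hpq using hbir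
  refine (Submodule.ne_bot_iff _).mpr ⟨∏ a ∈ s, i (q a), fun h => ?_,
    Finset.prod_ne_zero_iff.mpr fun a _ => hq a⟩
  have hh : h ∈ Submodule.span A (s : Set N) := hs ▸ Submodule.mem_top
  induction hh using Submodule.span_induction with
  | mem x hx =>
    classical
    rw [← Finset.prod_erase_mul _ _ hx, mul_assoc, hpq]
    exact mul_mem (prod_mem fun a _ => ⟨q a, rfl⟩) ⟨_, rfl⟩
  | zero => rw [mul_zero]; exact zero_mem _
  | add x y _ _ hx hy => rw [mul_add]; exact add_mem hx hy
  | smul a x _ hx =>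
    rw [Algebra.smul_def, mul_left_comm]
    exact mul_mem ⟨a, rfl⟩ hx

theorem MvPolynomial.mem_range_map {σ : Type*} {h : MvPolynomial σ N}
    (hh : ∀ m, h.coeff m ∈ i.range) : h ∈ (MvPolynomial.map (σ := σ) i).range := by
  refine MvPolynomial.mem_range_map_iff_coeffs_subset.mpr fun c hc => ?_
  obtain ⟨m, -, rfl⟩ := MvPolynomial.mem_coeffs_iff.mp hc
  exact hh m

theorem MvPolynomial.isIntegral_map {σ : Type*} (hi : i.IsIntegral) :
    (MvPolynomial.map (σ := σ) i).IsIntegral := by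
  intro h
  let _ := (MvPolynomial.map (σ := σ) i).toAlgebra
  induction h using MvPolynomial.induction_on with
  | C a =>
    obtain ⟨p, hp, hpa⟩ := hi a
    refine ⟨p.map MvPolynomial.C, hp.map _, ?_⟩
    have : (MvPolynomial.map (σ := σ) i).comp MvPolynomial.C = MvPolynomial.C.comp i :=
      RingHom.ext fun a => MvPolynomial.map_C i a
    rw [Polynomial.eval₂_map, this, ← Polynomial.hom_eval₂, hpa, map_zero]
  | add p q hp hq => exact IsIntegral.add (R := MvPolynomial σ A) hp hq
  | mul_X p n hp =>
    refine IsIntegral.mul (R := MvPolynomial σ A) hp ?_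
    rw [← MvPolynomial.map_X i n]
    exact isIntegral_algebraMap (R := MvPolynomial σ A)

theorem exists_conductor_natDegree_eq_zero [IsDomain A] [IsDomain N] [IsPrincipalIdealRing N]
    {σ k : Type*} [CommRing k] [Algebra k A] (hi : Function.Injective i) (hfin : i.Finite)
    (hbir : ∀ h : N, ∃ p q : A, i q ≠ 0 ∧ i q * h = i p)
    {φ : MvPolynomial σ A →ₐ[k] (MvPolynomial σ A)[X]} (hφ : IsExponential φ) :
    ∃ f : A, f ≠ 0 ∧ i f ∈ i.conductor ∧ (φ (MvPolynomial.C f)).natDegree = 0 := by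
  let j : MvPolynomial σ A →+* MvPolynomial σ N := MvPolynomial.map i
  have hj : Function.Injective j := MvPolynomial.map_injective i hi
  obtain ⟨g, hg⟩ := IsPrincipalIdealRing.principal i.conductor
  have hgc : g ∈ i.conductor := by rw [hg]; exact Submodule.mem_span_singleton_self g
  have hg0 : g ≠ 0 := by
    rintro rfl
    exact RingHom.conductor_ne_bot hfin hbir (hg.trans (by simp))
  obtain ⟨f, hf⟩ := hgc 1
  rw [mul_one] at hf
  subst hf
  have hf0 : f ≠ 0 := fun h => hg0 (by rw [h, map_zero])
  have hCf : ∀ h, j (MvPolynomial.C f) * h ∈ j.range := by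
    intro h
    refine MvPolynomial.mem_range_map fun m => ?_
    rw [MvPolynomial.map_C, MvPolynomial.coeff_C_mul]
    exact hgc _
  have hdvd : ∀ w, (∀ h, j w * h ∈ j.range) → j (MvPolynomial.C f) ∣ j w := by
    intro w hw
    rw [MvPolynomial.map_C, MvPolynomial.C_dvd_iff_dvd_coeff]
    intro m
    rw [← Ideal.mem_span_singleton, ← Ideal.submodule_span_eq, ← hg]
    intro h
    obtain ⟨v, hv⟩ := hw (MvPolynomial.C h)
    refine ⟨v.coeff m, ?_⟩
    rw [mul_comm, ← MvPolynomial.coeff_C_mul, mul_comm, ← hv, MvPolynomial.coeff_map]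
  have hbir' : ∀ h, ∃ p q, j q ≠ 0 ∧ j q * h = j p := by
    intro h
    obtain ⟨p, hp⟩ := hCf h
    exact ⟨p, MvPolynomial.C f, (map_ne_zero_iff j hj).mpr (by simpa using hf0), hp.symm⟩
  have hφ0 : Function.Injective φ := by
    intro a b hab
    rw [← hφ.1 a, hab, hφ.1]
  obtain ⟨Φ, hΦ⟩ := RingHom.exists_extension_polynomial hj
    (MvPolynomial.isIntegral_map hfin.to_isIntegral) hbir'
    (φ : MvPolynomial σ A →+* (MvPolynomial σ A)[X]) hφ0
  refine ⟨f, hf0, hgc, ?_⟩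
  set c : MvPolynomial σ A := MvPolynomial.C f with hc
  obtain ⟨h, hh⟩ := hdvd _ (hφ.coeff_mul_mem_range hΦ hbir' hCf (φ c).natDegree)
  rw [coeff_natDegree] at hh
  have hw := congrArg Φ hh
  rw [map_mul, hΦ, hΦ] at hw
  change (φ _).map j = (φ c).map j * Φ h at hw
  rw [hφ.apply_leadingCoeff, map_C] at hw
  have hc0 : φ c ≠ 0 := (map_ne_zero_iff φ hφ0).mpr (by simpa [hc] using hf0)
  have hne : C (j (φ c).leadingCoeff) ≠ 0 :=
    C_ne_zero.mpr ((map_ne_zero_iff j hj).mpr (leadingCoeff_ne_zero.mpr hc0))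
  have hdeg := congrArg natDegree hw
  rw [hw] at hne
  rw [natDegree_C, natDegree_mul (left_ne_zero_of_mul hne) (right_ne_zero_of_mul hne),
    natDegree_map_eq_of_injective hj] at hdeg
  omega

end Conductor

theorem IsExponential.apply_of_isAlgebraic {k R B : Type*} [CommRing k] [CommRing R] [CommRing B]
    [IsDomain B] [Algebra k B] [Algebra R B] {φ : B →ₐ[k] B[X]} (hφ : IsExponential φ)
    (hR : Function.Injective (algebraMap R B))
    (hφR : ∀ r, φ (algebraMap R B r) = C (algebraMap R B r)) {b : B} (hb : IsAlgebraic R b) :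
    φ b = C b := by
  by_contra hcon
  have hd : 0 < (φ b).natDegree := Nat.pos_of_ne_zero fun h => hcon (hφ.apply_eq_C h)
  let ψ : B →ₐ[R] B[X] := { (φ : B →+* B[X]) with commutes' := hφR }
  exact transcendental_of_natDegree_pos hR hd (hb.algHom ψ)

theorem exists_algEquiv_polynomial {F : Type*} {A : Type u} [Field F] [PerfectField F]
    [CommRing A] [IsDomain A] [Algebra F A] [Algebra.FiniteType F A] (htr : TrdegOne F A)
    {σ : Type} [Finite σ] {φ : MvPolynomial σ A →ₐ[F] (MvPolynomial σ A)[X]} (hφ : IsExponential φ)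
    {a : A} (ha : φ (MvPolynomial.C a) ≠ C (MvPolynomial.C a)) :
    ∃ (L : Type u) (_ : Field L) (_ : Algebra F L),
      FiniteDimensional F L ∧ Nonempty (A ≃ₐ[F] L[X]) := by
  have hd : 0 < (φ (MvPolynomial.C a)).natDegree :=
    Nat.pos_of_ne_zero fun h => ha (hφ.apply_eq_C h)
  obtain ⟨L, _, _, i, hL, hia, hbir⟩ := exists_birational_algHom_polynomial
    (φ.comp (IsScalarTower.toAlgHom F A (MvPolynomial σ A))) (a := a) hd
  have htrans : Transcendental F (i a) :=
    transcendental_of_natDegree_pos (algebraMap F L).injective hia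
  have := htr.isAlgebraic_adjoin (a := a) fun h => htrans (h.algHom i)
  have hinj : Function.Injective i := i.injective_of_transcendental htrans
  have hfin : (i : A →+* L[X]).Finite := by
    refine RingHom.IsIntegral.to_finite (i.isIntegral_of_natDegree_pos hia) ?_
    have : (algebraMap F L[X]).FiniteType := by
      rw [RingHom.finiteType_algebraMap]
      exact Algebra.FiniteType.trans (S := L) inferInstance inferInstance
    exact RingHom.FiniteType.of_comp_finiteType (f := algebraMap F A) (by simpa using this)
  obtain ⟨f, hf0, hfc, hfd⟩ := exists_conductor_natDegree_eq_zero (σ := σ) hinj hfin hbir hφ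
  refine ⟨L, inferInstance, inferInstance, hL, ⟨AlgEquiv.ofBijective i ⟨hinj, fun h => ?_⟩⟩⟩
  by_cases hfu : IsUnit (i f)
  · obtain ⟨u, hu⟩ := hfu
    obtain ⟨b, hb⟩ := hfc (↑u⁻¹ * h)
    exact ⟨b, by simpa [← hu] using hb⟩
  have hfpos : 0 < (i f).natDegree := by
    by_contra hcon
    refine hfu (isUnit_iff_degree_eq_zero.mpr ?_)
    rw [degree_eq_natDegree ((map_ne_zero_iff i hinj).mpr hf0)]
    simpa using hcon
  have htf : Transcendental F (i f) :=
    transcendental_of_natDegree_pos (algebraMap F L).injective hfpos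
  have hA := htr.isAlgebraic_adjoin (a := f) fun h => htf (h.algHom i)
  refine absurd (hφ.apply_of_isAlgebraic (R := Algebra.adjoin F {f}) ?_ ?_ ?_) ha
  · exact (MvPolynomial.C_injective σ A).comp Subtype.val_injective
  · rintro ⟨r, hr⟩
    have hle : Algebra.adjoin F {f} ≤ (expInvariants φ).comap
        (IsScalarTower.toAlgHom F A (MvPolynomial σ A)) :=
      Algebra.adjoin_le (Set.singleton_subset_iff.mpr (hφ.apply_eq_C hfd))
    exact hle hr
  · exact (hA.isAlgebraic a).algHom
      (IsScalarTower.toAlgHom (Algebra.adjoin F {f}) A (MvPolynomial σ A))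

theorem mem_AK {k A : Type*} [CommRing k] [CommRing A] [Algebra k A] {a : A} :
    a ∈ AK k A ↔ ∀ φ : A →ₐ[k] A[X], IsExponential φ → φ a = C a := by
  rw [AK, Algebra.mem_iInf]
  exact ⟨fun h φ hφ => h ⟨φ, hφ⟩, fun h φ => h φ.1 φ.2⟩

theorem isExponential_iff {k A : Type*} [CommRing k] [CommRing A] [Algebra k A]
    {φ : A →ₐ[k] A[X]} : IsExponential φ ↔
      (evalRingHom 0).comp (φ : A →+* A[X]) = RingHom.id A ∧
      (mapRingHom (φ : A →+* A[X])).comp (φ : A →+* A[X]) =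
        (eval₂RingHom ((C : A[X] →+* A[X][X]).comp (C : A →+* A[X])) (X + C X)).comp
          (φ : A →+* A[X]) := by
  simp only [RingHom.ext_iff]
  rfl

namespace MvPolynomial

variable {k A σ : Type*} [CommRing k] [CommRing A] [Algebra k A]

/-- The algebra homomorphism `A[x] → A[x][t]` that extends `ψ : A → A[t]` and sends `x i` to
`x i + y i`. -/
noncomputable def extendPolynomial (ψ : A →ₐ[k] A[X]) (y : σ → (MvPolynomial σ A)[X]) :
    MvPolynomial σ A →ₐ[k] (MvPolynomial σ A)[X] :=
  { eval₂Hom ((mapRingHom MvPolynomial.C).comp (ψ : A →+* A[X]))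
      (fun i => Polynomial.C (MvPolynomial.X i) + y i) with
    commutes' := fun r => by
      rw [IsScalarTower.algebraMap_apply k A (MvPolynomial σ A)]
      simp [MvPolynomial.algebraMap_eq, IsScalarTower.algebraMap_apply k A A[X],
        IsScalarTower.algebraMap_apply k A (MvPolynomial σ A),
        IsScalarTower.algebraMap_apply k (MvPolynomial σ A) (MvPolynomial σ A)[X]] }

theorem extendPolynomial_C (ψ : A →ₐ[k] A[X]) (y : σ → (MvPolynomial σ A)[X]) (a : A) :
    extendPolynomial ψ y (MvPolynomial.C a) = (ψ a).map MvPolynomial.C :=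
  eval₂Hom_C _ _ a

theorem extendPolynomial_X (ψ : A →ₐ[k] A[X]) (y : σ → (MvPolynomial σ A)[X]) (i : σ) :
    extendPolynomial ψ y (MvPolynomial.X i) = Polynomial.C (MvPolynomial.X i) + y i :=
  eval₂Hom_X' _ _ i

theorem isExponential_extendPolynomial {ψ : A →ₐ[k] A[X]} (hψ : IsExponential ψ)
    {y : σ → (MvPolynomial σ A)[X]} (hy : ∀ i, y i = 0 ∨ y i = Polynomial.X) :
    IsExponential (extendPolynomial ψ y) := by
  rw [isExponential_iff]
  have hC : ((extendPolynomial ψ y : MvPolynomial σ A →+* (MvPolynomial σ A)[X])).comp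
      MvPolynomial.C = (mapRingHom MvPolynomial.C).comp (ψ : A →+* A[X]) :=
    RingHom.ext (extendPolynomial_C ψ y)
  refine ⟨ringHom_ext (fun a => ?_) fun i => ?_, ringHom_ext (fun a => ?_) fun i => ?_⟩
  · have := congrArg (MvPolynomial.C (σ := σ)) (hψ.1 a)
    simpa [extendPolynomial_C, eval_map, eval₂_at_zero] using this
  · rcases hy i with h | h <;> simp [extendPolynomial_X, h]
  · have h := congrArg (Polynomial.map (mapRingHom (MvPolynomial.C (σ := σ)))) (hψ.2 a)
    simp only [RingHom.comp_apply, RingHom.coe_coe, extendPolynomial_C, coe_mapRingHom,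
      Polynomial.map_map, hC, coe_eval₂RingHom, Polynomial.eval₂_map] at h ⊢
    rw [h, ← coe_mapRingHom, Polynomial.hom_eval₂]
    congr 1
    · ext; simp
    · simp
  · rcases hy i with h | h <;> simp [extendPolynomial_X, h, add_assoc, add_left_comm]
    abel

theorem isExponential_CAlgHom : IsExponential (CAlgHom : A →ₐ[k] A[X]) :=
  ⟨fun a => by simp, fun a => by simp⟩

theorem eq_C_of_mem_AK {p : MvPolynomial σ A} (hp : p ∈ AK k (MvPolynomial σ A)) :
    ∃ a, p = MvPolynomial.C a := by
  classical
  have hvars : p.vars = ∅ := by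
    refine Finset.eq_empty_of_forall_notMem fun i hi => ?_
    let φ : MvPolynomial σ A →ₐ[k] (MvPolynomial σ A)[X] :=
      extendPolynomial (CAlgHom : A →ₐ[k] A[X]) (fun j => if j = i then Polynomial.X else 0)
    have hφ : IsExponential φ := isExponential_extendPolynomial isExponential_CAlgHom fun j => by
      by_cases h : j = i <;> simp [h]
    have h := congrArg (Polynomial.eval (-MvPolynomial.X i)) (mem_AK.mp hp φ hφ)
    have h1 : (Polynomial.evalRingHom (-MvPolynomial.X i)).comp (φ : MvPolynomial σ A →+* _) =
        ((bind₁ (Function.update MvPolynomial.X i 0) : MvPolynomial σ A →ₐ[A] MvPolynomial σ A) :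
          MvPolynomial σ A →+* MvPolynomial σ A) := by
      refine ringHom_ext (fun a => ?_) fun j => ?_
      · simp [φ, extendPolynomial_C]
      · by_cases h : j = i
        · subst h; simp [φ, extendPolynomial_X]
        · simp [φ, extendPolynomial_X, h]
    have h2 : bind₁ (Function.update MvPolynomial.X i 0) p = p := by
      have := RingHom.congr_fun h1 p
      simp at this h
      rw [← this]
      exact h
    rw [← h2] at hi
    obtain ⟨j, -, hj⟩ := Finset.mem_biUnion.mp (vars_bind₁ _ _ hi)
    by_cases hji : j = i
    · subst hji
      simp at hj
    · rw [Function.update_of_ne hji] at hj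
      rcases subsingleton_or_nontrivial A with _ | _
      · simp [Subsingleton.elim (MvPolynomial.X j : MvPolynomial σ A) 0] at hj
      · rw [vars_X, Finset.mem_singleton] at hj
        exact hji hj.symm
  exact ⟨_, vars_eq_empty_iff_eq_C.mp hvars⟩

end MvPolynomial

theorem IsExponential.conj {k A D : Type*} [CommRing k] [CommRing A] [Algebra k A] [CommRing D]
    [Algebra k D] {φ : D →ₐ[k] D[X]} (hφ : IsExponential φ) (e : A ≃ₐ[k] D) :
    IsExponential ((mapAlgHom (e.symm : D →ₐ[k] A)).comp (φ.comp (e : A →ₐ[k] D))) := by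
  set φ' := (mapAlgHom (e.symm : D →ₐ[k] A)).comp (φ.comp (e : A →ₐ[k] D)) with hφ'
  have hC : (φ' : A →+* A[X]).comp (e.symm : D →+* A) =
      (mapRingHom (e.symm : D →+* A)).comp (φ : D →+* D[X]) := by
    ext1 d
    simp [hφ']
  have happ : ∀ a, φ' a = (φ (e a)).map (e.symm : D →+* A) := fun a => rfl
  constructor
  · intro a
    have := congrArg e.symm (hφ.1 (e a))
    rw [happ, eval_map, eval₂_at_zero]
    simpa [coeff_zero_eq_eval_zero] using this
  · intro a
    have h := congrArg (Polynomial.map (mapRingHom (e.symm : D →+* A))) (hφ.2 (e a))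
    rw [Polynomial.map_map, ← hC] at h
    rw [happ, Polynomial.map_map, h, ← coe_mapRingHom, hom_eval₂, eval₂_map]
    congr 1
    · ext; simp
    · simp

theorem isExponential_translation (k L : Type*) [CommRing k] [CommRing L] [Algebra k L] :
    IsExponential ((aeval (X + C X : L[X][X]) : L[X] →ₐ[L] L[X][X]).restrictScalars k) := by
  rw [isExponential_iff]
  refine ⟨ringHom_ext (fun a => ?_) ?_, ringHom_ext (fun a => ?_) ?_⟩
  · simp [IsScalarTower.algebraMap_apply L L[X] L[X][X]]
  · simp
  · simp [IsScalarTower.algebraMap_apply L L[X] L[X][X]]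
  · simp
    abel

theorem isAlgebraic_of_mem_AK {F A L : Type*} [Field F] [CommRing A] [Algebra F A] [Field L]
    [Algebra F L] [FiniteDimensional F L] (e : A ≃ₐ[F] L[X]) {a : A} (ha : a ∈ AK F A) :
    IsAlgebraic F a := by
  have h := congrArg (Polynomial.map (e : A →+* L[X]))
    (mem_AK.mp ha _ ((isExponential_translation F L).conj e))
  have hee : (e : A →+* L[X]).comp (e.symm : L[X] →+* A) = RingHom.id _ :=
    RingHom.ext fun f => e.apply_symm_apply f
  change ((aeval (X + C X : L[X][X]) (e a)).map (e.symm : L[X] →+* A)).map _ = _ at h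
  rw [Polynomial.map_map, hee, Polynomial.map_id, map_C] at h
  have hcomp : aeval (X + C X : L[X][X]) (e a) = ((e a).map C).comp (X + C X) := by
    rw [comp, eval₂_map, aeval_def]
    rfl
  have hd := congrArg natDegree h
  rw [hcomp, natDegree_comp, natDegree_X_add_C, mul_one, natDegree_C,
    natDegree_map_eq_of_injective C_injective] at hd
  have hl : IsAlgebraic F (e a) := by
    rw [eq_C_of_natDegree_eq_zero hd]
    exact (Algebra.IsAlgebraic.isAlgebraic (R := F) ((e a).coeff 0)).algHom
      (IsScalarTower.toAlgHom F L L[X])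
  simpa using hl.algHom (e.symm : L[X] →ₐ[F] A)

/-- For a perfect field `F` and an affine domain `A` over `F` of transcendence degree 1,
`AK(A[x₁, …, xₙ]) = AK(A)` (with `A` embedded as constants). -/
theorem ak_mvPolynomial_eq_ak
    {F A : Type*} [Field F] [PerfectField F]
    [CommRing A] [IsDomain A] [Algebra F A] [Algebra.FiniteType F A]
    (htr : TrdegOne F A) (n : ℕ) :
    AK F (MvPolynomial (Fin n) A) =
      (AK F A).map (IsScalarTower.toAlgHom F A (MvPolynomial (Fin n) A)) := by
  have hinj :
      Function.Injective (Polynomial.map (MvPolynomial.C : A →+* MvPolynomial (Fin n) A)) :=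
    map_injective _ (MvPolynomial.C_injective _ _)
  apply le_antisymm
  · intro p hp
    obtain ⟨a, rfl⟩ := MvPolynomial.eq_C_of_mem_AK hp
    refine ⟨a, mem_AK.mpr fun ψ hψ => hinj ?_, rfl⟩
    have h := mem_AK.mp hp _ (MvPolynomial.isExponential_extendPolynomial hψ (y := 0)
      fun _ => Or.inl rfl)
    rwa [MvPolynomial.extendPolynomial_C, ← map_C] at h
  · rintro _ ⟨a, ha, rfl⟩
    refine mem_AK.mpr fun φ hφ => ?_
    change φ (MvPolynomial.C a) = C (MvPolynomial.C a)
    by_contra hcon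
    obtain ⟨L, _, _, _, ⟨e⟩⟩ := exists_algEquiv_polynomial htr hφ hcon
    have hal : IsAlgebraic F (MvPolynomial.C a : MvPolynomial (Fin n) A) :=
      (isAlgebraic_of_mem_AK e ha).algHom (IsScalarTower.toAlgHom F A (MvPolynomial (Fin n) A))
    refine hcon (hφ.apply_of_isAlgebraic (R := F) (algebraMap F _).injective (fun r => ?_) hal)
    exact φ.commutes r
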